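/- Let ρ = Σ_i p_i ρ_i^A ⊗ ρ_i^B be a separable bipartite state. If all steered states ρ_B^M (over all POVM elements M with tr((M⊗I)ρ) > 0) commute with the reduced state ρ_B and with each other, then all the ρ_i^B with p_i > 0 that can be distinguished by some M commute pairwise; consequently ρ can be written in the classical form Σ_i q_i σ_i^A ⊗ |ξ_i⟩⟨ξ_i| for some orthonormal basis {|ξ_i⟩} of H_B. -/

import Mathlib

open Matrix BigOperators Kronecker ComplexOrder

noncomputable section

def ptraceA {dA dB : ℕ} (ρ : Matrix (Fin dA × Fin dB) (Fin dA × Fin dB) ℂ) :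
    Matrix (Fin dB) (Fin dB) ℂ :=
  fun j j' => ∑ a, ρ (a, j) (a, j')

def proj {n : ℕ} (x : Fin n → ℂ) : Matrix (Fin n) (Fin n) ℂ :=
  vecMulVec x (star x)

/-- A POVM element: positive semidefinite and ≤ I. -/
def IsPOVMElem {d : ℕ} (M : Matrix (Fin d) (Fin d) ℂ) : Prop :=
  M.PosSemidef ∧ (1 - M).PosSemidef

/-- The steered state of Bob given Alice's POVM element M. -/
def steered {dA dB : ℕ} (ρ : Matrix (Fin dA × Fin dB) (Fin dA × Fin dB) ℂ)
    (M : Matrix (Fin dA) (Fin dA) ℂ) : Matrix (Fin dB) (Fin dB) ℂ :=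
  (((M ⊗ₖ (1 : Matrix (Fin dB) (Fin dB) ℂ)) * ρ).trace)⁻¹ •
    ptraceA ((M ⊗ₖ 1) * ρ)

lemma aux_ptrace {dA dB N : ℕ} (p : Fin N → ℝ)
    (ρA : Fin N → Matrix (Fin dA) (Fin dA) ℂ) (ρB : Fin N → Matrix (Fin dB) (Fin dB) ℂ)
    (M : Matrix (Fin dA) (Fin dA) ℂ) :
    ptraceA ((M ⊗ₖ (1 : Matrix (Fin dB) (Fin dB) ℂ)) * ∑ i, (p i : ℂ) • (ρA i ⊗ₖ ρB i))
      = ∑ i, ((p i : ℂ) * (M * ρA i).trace) • ρB i := by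
  have h : (M ⊗ₖ (1 : Matrix (Fin dB) (Fin dB) ℂ)) * ∑ i, (p i : ℂ) • (ρA i ⊗ₖ ρB i)
      = ∑ i, (p i : ℂ) • ((M * ρA i) ⊗ₖ ρB i) := by
    rw [Finset.mul_sum]
    refine Finset.sum_congr rfl fun i _ => ?_
    rw [Matrix.mul_smul, ← Matrix.mul_kronecker_mul, Matrix.one_mul]
  rw [h]
  ext j k
  simp only [ptraceA, Matrix.sum_apply, Matrix.smul_apply, Matrix.kronecker_apply, smul_eq_mul,
    Matrix.trace, Matrix.diag]
  rw [Finset.sum_comm]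
  refine Finset.sum_congr rfl fun i _ => ?_
  rw [Finset.mul_sum, Finset.sum_mul]
  refine Finset.sum_congr rfl fun a _ => ?_
  ring

lemma aux_trace_ptrace {dA dB : ℕ} (ρ : Matrix (Fin dA × Fin dB) (Fin dA × Fin dB) ℂ) :
    ρ.trace = (ptraceA ρ).trace := by
  simp only [Matrix.trace, Matrix.diag, ptraceA, Fintype.sum_prod_type]
  rw [Finset.sum_comm]

lemma aux_scale {d : ℕ} (M : Matrix (Fin d) (Fin d) ℂ) (hM : M.PosSemidef) :
    ∃ c : ℝ, 0 < c ∧ IsPOVMElem ((c : ℂ) • M) := by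
  open scoped MatrixOrder Matrix.Norms.L2Operator in
  have h : M ≤ algebraMap ℝ (Matrix (Fin d) (Fin d) ℂ) ‖M‖ :=
    IsSelfAdjoint.le_algebraMap_norm_self (show IsSelfAdjoint M from hM.1)
  open scoped MatrixOrder Matrix.Norms.L2Operator in
  have h2 : ∃ r : ℝ, 0 ≤ r ∧ ((r : ℂ) • (1 : Matrix (Fin d) (Fin d) ℂ) - M).PosSemidef := by
    refine ⟨‖M‖, norm_nonneg _, ?_⟩
    rw [Matrix.le_iff, Algebra.algebraMap_eq_smul_one] at h
    simpa using h
  obtain ⟨r, hr, h2⟩ := h2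
  have hr1 : 0 < r + 1 := by linarith
  have h3 : (0 : ℂ) ≤ (((r + 1)⁻¹ : ℝ) : ℂ) := by
    exact_mod_cast (inv_pos.mpr hr1).le
  refine ⟨(r + 1)⁻¹, inv_pos.mpr hr1, hM.smul h3, ?_⟩
  have h4 : (1 : Matrix (Fin d) (Fin d) ℂ) - (((r + 1)⁻¹ : ℝ) : ℂ) • M
      = (((r + 1)⁻¹ : ℝ) : ℂ) • (((r : ℂ) • (1 : Matrix (Fin d) (Fin d) ℂ) - M) + 1) := by
    have h5 : (r : ℂ) + 1 ≠ 0 := by exact_mod_cast hr1.ne'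
    have h6 : (1 : Matrix (Fin d) (Fin d) ℂ) =
        (((r + 1)⁻¹ : ℝ) : ℂ) • ((r + 1 : ℂ) • (1 : Matrix (Fin d) (Fin d) ℂ)) := by
      rw [smul_smul]; push_cast; rw [inv_mul_cancel₀ h5, one_smul]
    conv_lhs => rw [h6]
    rw [← smul_sub]
    congr 1
    rw [add_smul, one_smul]; abel
  rw [h4]
  exact (h2.add Matrix.PosSemidef.one).smul h3

lemma aux_diag_abs {d : ℕ} {ι E : Type*} [NormedAddCommGroup E] [InnerProductSpace ℂ E]
    [FiniteDimensional ℂ E] (hd : Module.finrank ℂ E = d) (L : ι → Module.End ℂ E)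
    (hL : ∀ i, (L i).IsSymmetric) (hcL : Pairwise (Function.onFun Commute L)) :
    ∃ w : Fin d → E, Orthonormal ℂ w ∧ ∀ i k, ∃ μ : ℂ, L i (w k) = μ • w k := by
  classical
  have htop := LinearMap.IsSymmetric.iSup_iInf_eq_top_of_commute hL hcL
  have horth := LinearMap.IsSymmetric.orthogonalFamily_iInf_eigenspaces hL
  obtain ⟨V, hV⟩ : ∃ V : (ι → ℂ) → Submodule ℂ E,
    V = fun χ => ⨅ j, Module.End.eigenspace (L j) (χ j) := ⟨_, rfl⟩
  rw [show (fun γ : ι → ℂ => ⨅ j, Module.End.eigenspace (L j) (γ j)) = V from hV.symm] at htop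
  have horth' : OrthogonalFamily ℂ (fun χ => V χ) fun χ => (V χ).subtypeₗᵢ := by
    rw [hV]; exact horth
  clear horth
  have hmem : ∀ χ x, x ∈ V χ → ∀ i, L i x = χ i • x := by
    intro χ x hx i
    rw [hV] at hx
    exact Module.End.mem_eigenspace_iff.mp ((Submodule.mem_iInf _).mp hx i)
  clear hV
  have b : ∀ χ, OrthonormalBasis (Fin (Module.finrank ℂ (V χ))) ℂ (V χ) :=
    fun χ => stdOrthonormalBasis ℂ (V χ)
  let v : (Σ χ : ι → ℂ, Fin (Module.finrank ℂ (V χ))) → E :=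
    fun s => (b s.1 s.2 : E)
  have hv : Orthonormal ℂ v :=
    horth'.orthonormal_sigma_orthonormal (fun χ => (b χ).orthonormal)
  have hspan : ⊤ ≤ Submodule.span ℂ (Set.range v) := by
    rw [← htop]
    refine iSup_le fun χ => ?_
    intro x hx
    have h1 := (b χ).sum_repr ⟨x, hx⟩
    have h2 := congrArg (Subtype.val) h1
    simp only [Submodule.coe_sum, Submodule.coe_smul] at h2
    rw [← h2]
    refine Submodule.sum_mem _ fun k _ => Submodule.smul_mem _ _ (Submodule.subset_span ?_)
    exact ⟨⟨χ, k⟩, rfl⟩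
  have B0 := Module.Basis.mk hv.linearIndependent hspan
  haveI : Finite (Σ χ : ι → ℂ, Fin (Module.finrank ℂ (V χ))) :=
    hv.linearIndependent.finite
  haveI := Fintype.ofFinite (Σ χ : ι → ℂ, Fin (Module.finrank ℂ (V χ)))
  have hcard : Fintype.card (Σ χ : ι → ℂ, Fin (Module.finrank ℂ (V χ))) = d := by
    rw [← Module.finrank_eq_card_basis B0, hd]
  have e := Fintype.equivFinOfCardEq hcard
  refine ⟨fun k => v (e.symm k), hv.comp _ e.symm.injective, fun i k => ?_⟩
  exact ⟨(e.symm k).1 i, hmem _ _ (b _ _).2 i⟩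

/-- Simultaneous unitary diagonalization of a commuting family of Hermitian matrices. -/
lemma aux_diag {d : ℕ} {ι : Type*} (T : ι → Matrix (Fin d) (Fin d) ℂ)
    (hT : ∀ i, (T i).IsHermitian) (hc : ∀ i j, T i * T j = T j * T i) :
    ∃ ξ : Fin d → (Fin d → ℂ),
      (∀ i j, star (ξ i) ⬝ᵥ ξ j = if i = j then (1 : ℂ) else 0) ∧
      ∀ i k, ∃ μ : ℂ, T i *ᵥ ξ k = μ • ξ k := by
  classical
  obtain ⟨w, hw, hev⟩ := aux_diag_abs (E := EuclideanSpace ℂ (Fin d)) finrank_euclideanSpace_fin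
    (fun i => (T i).toEuclideanLin) (fun i => isSymmetric_toEuclideanLin_iff.mpr (hT i))
    (by
      intro i j _
      show (T i).toEuclideanLin * (T j).toEuclideanLin = (T j).toEuclideanLin * (T i).toEuclideanLin
      refine LinearMap.ext fun v => ?_
      simp only [Module.End.mul_apply, Matrix.toLpLin_apply, Matrix.mulVec_mulVec, hc i j])
  refine ⟨fun k => (w k).ofLp, fun i j => ?_, fun i k => ?_⟩
  · have := orthonormal_iff_ite.mp hw i j
    rw [EuclideanSpace.inner_eq_star_dotProduct, dotProduct_comm] at this
    exact this
  · obtain ⟨μ, h1⟩ := hev i k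
    refine ⟨μ, ?_⟩
    have h2 := congrArg WithLp.ofLp h1
    simpa [Matrix.toLpLin_apply] using h2

lemma aux_polar {d : ℕ} (T : Matrix (Fin d) (Fin d) ℂ)
    (h : ∀ x : Fin d → ℂ, star x ⬝ᵥ (T *ᵥ x) = 0) : T = 0 := by
  have : T.toEuclideanLin = 0 := by
    rw [← inner_map_self_eq_zero]
    intro x
    rw [← inner_conj_symm, EuclideanSpace.inner_eq_star_dotProduct, dotProduct_comm]
    simp [Matrix.toLpLin_apply, h]
  simpa using this

/-- for a separable state ρ = Σ p_i ρ_i^A ⊗ ρ_i^B, if all steered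
states commute with the reduced state ρ_B and with each other, then ρ can be
written in the B-classical form Σ q_i σ_i^A ⊗ |ξ_i⟩⟨ξ_i|. -/
theorem stmt2 {dA dB N : ℕ}
    (ρ : Matrix (Fin dA × Fin dB) (Fin dA × Fin dB) ℂ)
    (p : Fin N → ℝ) (hp : ∀ i, 0 ≤ p i) (hpsum : ∑ i, p i = 1)
    (ρA : Fin N → Matrix (Fin dA) (Fin dA) ℂ)
    (hρA : ∀ i, (ρA i).PosSemidef ∧ (ρA i).trace = 1)
    (ρB : Fin N → Matrix (Fin dB) (Fin dB) ℂ)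
    (hρB : ∀ i, (ρB i).PosSemidef ∧ (ρB i).trace = 1)
    (hρ : ρ = ∑ i, (p i : ℂ) • (ρA i ⊗ₖ ρB i))
    (hcommB : ∀ M, IsPOVMElem M → 0 < (((M ⊗ₖ (1 : Matrix (Fin dB) (Fin dB) ℂ)) * ρ).trace).re →
      steered ρ M * ptraceA ρ = ptraceA ρ * steered ρ M)
    (hcomm : ∀ M M', IsPOVMElem M → IsPOVMElem M' →
      0 < (((M ⊗ₖ (1 : Matrix (Fin dB) (Fin dB) ℂ)) * ρ).trace).re →
      0 < (((M' ⊗ₖ (1 : Matrix (Fin dB) (Fin dB) ℂ)) * ρ).trace).re →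
      steered ρ M * steered ρ M' = steered ρ M' * steered ρ M) :
    ∃ (q : Fin dB → ℝ) (σA : Fin dB → Matrix (Fin dA) (Fin dA) ℂ)
      (ξ : Fin dB → (Fin dB → ℂ)),
      (∀ i, 0 ≤ q i) ∧ (∑ i, q i = 1) ∧
      (∀ i, (σA i).PosSemidef ∧ (σA i).trace = 1) ∧
      (∀ i j, star (ξ i) ⬝ᵥ ξ j = if i = j then (1 : ℂ) else 0) ∧
      ρ = ∑ i, (q i : ℂ) • (σA i ⊗ₖ proj (ξ i)) := by
  classical
  let X : Matrix (Fin dA) (Fin dA) ℂ → Matrix (Fin dB) (Fin dB) ℂ :=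
    fun M => ∑ i, ((p i : ℂ) * (M * ρA i).trace) • ρB i
  have hX : ∀ M, ptraceA ((M ⊗ₖ (1 : Matrix (Fin dB) (Fin dB) ℂ)) * ρ) = X M := by
    intro M; rw [hρ]; exact aux_ptrace p ρA ρB M
  have htr : ∀ M, ((M ⊗ₖ (1 : Matrix (Fin dB) (Fin dB) ℂ)) * ρ).trace = (X M).trace := by
    intro M; rw [aux_trace_ptrace, hX]
  have hXsmul : ∀ (c : ℂ) M, X (c • M) = c • X M := by
    intro c M
    simp only [X, Finset.smul_sum, smul_smul, Matrix.smul_mul, Matrix.trace_smul, smul_eq_mul]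
    refine Finset.sum_congr rfl fun i _ => ?_
    congr 1; ring
  -- positivity of the unnormalised steered states, for rank one measurement operators
  let P : (Fin dA → ℂ) → Matrix (Fin dA) (Fin dA) ℂ := fun x => vecMulVec x (star x)
  have hP : ∀ x, (P x).PosSemidef := fun x => posSemidef_vecMulVec_self_star x
  have hPtr : ∀ x (A : Matrix (Fin dA) (Fin dA) ℂ), (P x * A).trace = star x ⬝ᵥ (A *ᵥ x) := by
    intro x A
    rw [Matrix.trace_mul_comm, Matrix.mul_vecMulVec, Matrix.trace_vecMulVec, dotProduct_comm]
  have hXpos : ∀ x, (X (P x)).PosSemidef := by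
    intro x
    refine Matrix.posSemidef_sum _ fun i _ => (hρB i).1.smul ?_
    rw [hPtr]
    exact mul_nonneg (by exact_mod_cast hp i) ((hρA i).1.dotProduct_mulVec_nonneg x)
  have hXcomm : ∀ x y, X (P x) * X (P y) = X (P y) * X (P x) := by
    intro x y
    by_cases hx : (X (P x)).trace = 0
    · rw [(hXpos x).trace_eq_zero_iff.mp hx]; simp
    by_cases hy : (X (P y)).trace = 0
    · rw [(hXpos y).trace_eq_zero_iff.mp hy]; simp
    have hxp : 0 < (X (P x)).trace := lt_of_le_of_ne (hXpos x).trace_nonneg (Ne.symm hx)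
    have hyp : 0 < (X (P y)).trace := lt_of_le_of_ne (hXpos y).trace_nonneg (Ne.symm hy)
    obtain ⟨c, hc, hcM⟩ := aux_scale (P x) (hP x)
    obtain ⟨c', hc', hcM'⟩ := aux_scale (P y) (hP y)
    have hcc : (c : ℂ) ≠ 0 := by exact_mod_cast hc.ne'
    have hcc' : (c' : ℂ) ≠ 0 := by exact_mod_cast hc'.ne'
    have h := hcomm _ _ hcM hcM'
      (by rw [htr, hXsmul, Matrix.trace_smul, smul_eq_mul, Complex.re_ofReal_mul]
          exact mul_pos hc (Complex.pos_iff.mp hxp).1)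
      (by rw [htr, hXsmul, Matrix.trace_smul, smul_eq_mul, Complex.re_ofReal_mul]
          exact mul_pos hc' (Complex.pos_iff.mp hyp).1)
    simp only [steered, hX, htr, hXsmul, Matrix.trace_smul, smul_eq_mul, smul_smul,
      Matrix.smul_mul, Matrix.mul_smul] at h
    rw [mul_comm (((c' : ℂ) * _)⁻¹ * _)] at h
    refine smul_right_injective _ ?_ h
    exact mul_ne_zero (mul_ne_zero (inv_ne_zero (mul_ne_zero hcc hx)) hcc)
      (mul_ne_zero (inv_ne_zero (mul_ne_zero hcc' hy)) hcc')
  obtain ⟨ξ, hξ, hdiag⟩ := aux_diag (fun x => X (P x)) (fun x => (hXpos x).1) hXcomm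
  -- matrix elements of the blocks in the joint eigenbasis
  let W : Fin dB → Fin dB → Matrix (Fin dA) (Fin dA) ℂ :=
    fun k l => ∑ i, ((p i : ℂ) * (star (ξ k) ⬝ᵥ (ρB i *ᵥ ξ l))) • ρA i
  have hWform : ∀ k l x, star x ⬝ᵥ (W k l *ᵥ x) = star (ξ k) ⬝ᵥ (X (P x) *ᵥ ξ l) := by
    intro k l x
    simp only [W, X, Matrix.sum_mulVec, dotProduct_sum, Matrix.smul_mulVec, dotProduct_smul,
      smul_eq_mul, hPtr]
    refine Finset.sum_congr rfl fun i _ => ?_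
    ring
  have hW0 : ∀ k l, k ≠ l → W k l = 0 := by
    intro k l hkl
    refine aux_polar _ fun x => ?_
    obtain ⟨μ, hμ⟩ := hdiag x l
    rw [hWform, hμ, dotProduct_smul, hξ, if_neg hkl, smul_zero]
  have hWpos : ∀ k, (W k k).PosSemidef := by
    intro k
    refine Matrix.posSemidef_sum _ fun i _ => (hρA i).1.smul ?_
    exact mul_nonneg (by exact_mod_cast hp i) ((hρB i).1.dotProduct_mulVec_nonneg _)
  -- completeness relation
  let U : Matrix (Fin dB) (Fin dB) ℂ := Matrix.of fun j k => ξ k j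
  have hU : Uᴴ * U = 1 := by
    ext k l
    have := hξ k l
    simpa [U, Matrix.mul_apply, dotProduct, Matrix.one_apply] using this
  have hU' : U * Uᴴ = 1 := mul_eq_one_comm.mp hU
  have hentry : ∀ (A : Matrix (Fin dB) (Fin dB) ℂ) k l,
      (Uᴴ * A * U) k l = star (ξ k) ⬝ᵥ (A *ᵥ ξ l) := by
    intro A k l
    rw [Matrix.mul_assoc]
    simp [U, Matrix.mul_apply, dotProduct, Matrix.mulVec]
  have hmain : ρ = ∑ k, W k k ⊗ₖ proj (ξ k) := by
    ext ⟨a, j⟩ ⟨a', j'⟩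
    let R : Matrix (Fin dB) (Fin dB) ℂ := ∑ i, ((p i : ℂ) * ρA i a a') • ρB i
    have hR : ρ (a, j) (a', j') = R j j' := by
      rw [hρ]
      simp only [R, Matrix.sum_apply, Matrix.smul_apply, Matrix.kronecker_apply, smul_eq_mul,
        mul_assoc]
    have hD : Uᴴ * R * U = Matrix.diagonal fun k => W k k a a' := by
      ext k l
      have h1 : (Uᴴ * R * U) k l = W k l a a' := by
        rw [hentry]
        simp only [W, R, Matrix.sum_mulVec, dotProduct_sum, Matrix.smul_mulVec, dotProduct_smul,
          smul_eq_mul, Matrix.sum_apply, Matrix.smul_apply]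
        refine Finset.sum_congr rfl fun i _ => ?_
        ring
      rw [h1, Matrix.diagonal_apply]
      split_ifs with hkl
      · rw [hkl]
      · rw [hW0 k l hkl]; rfl
    have hR2 : R = U * (Matrix.diagonal fun k => W k k a a') * Uᴴ := by
      rw [← hD]
      calc R = (U * Uᴴ) * R * (U * Uᴴ) := by rw [hU']; simp
        _ = _ := by simp only [Matrix.mul_assoc]
    rw [hR, hR2, Matrix.mul_apply, Matrix.sum_apply]
    refine Finset.sum_congr rfl fun k _ => ?_
    rw [Matrix.mul_diagonal, Matrix.kronecker_apply]
    simp only [U, proj, vecMulVec_apply, Matrix.of_apply, Matrix.conjTranspose_apply,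
      Pi.star_apply]
    ring
  have hqtr : ∀ k, (((W k k).trace.re : ℝ) : ℂ) = (W k k).trace := by
    intro k
    have := Complex.nonneg_iff.mp (hWpos k).trace_nonneg
    apply Complex.ext <;> simp [this.2.symm]
  have hN : Nonempty (Fin N) := by
    by_contra hne
    rw [not_nonempty_iff] at hne
    simp at hpsum
  obtain ⟨i0⟩ := hN
  have hprojtr : ∀ k, (proj (ξ k)).trace = 1 := by
    intro k
    rw [proj, Matrix.trace_vecMulVec, dotProduct_comm, hξ, if_pos rfl]
  refine ⟨fun k => (W k k).trace.re,
    fun k => if (W k k).trace = 0 then ρA i0 else ((W k k).trace)⁻¹ • W k k, ξ,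
    fun k => (Complex.nonneg_iff.mp (hWpos k).trace_nonneg).1, ?_, ?_, hξ, ?_⟩
  · have h1 : ρ.trace = 1 := by
      rw [hρ, Matrix.trace_sum]
      simp only [Matrix.trace_smul, Matrix.trace_kronecker, (hρA _).2, (hρB _).2, mul_one,
        smul_eq_mul]
      exact_mod_cast hpsum
    have h2 : ρ.trace = ∑ k, (W k k).trace := by
      rw [hmain, Matrix.trace_sum]
      simp only [Matrix.trace_kronecker, hprojtr, mul_one]
    rw [← Complex.re_sum, ← h2, h1, Complex.one_re]
  · intro k
    dsimp only
    split_ifs with h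
    · exact hρA i0
    · refine ⟨(hWpos k).smul ?_, ?_⟩
      · exact inv_nonneg.mpr (hWpos k).trace_nonneg
      · rw [Matrix.trace_smul, smul_eq_mul, inv_mul_cancel₀ h]
  · rw [hmain]
    refine Finset.sum_congr rfl fun k _ => ?_
    rw [hqtr]
    dsimp only
    split_ifs with h
    · rw [h, (hWpos k).trace_eq_zero_iff.mp h]; simp
    · rw [Matrix.smul_kronecker, smul_smul, mul_inv_cancel₀ h, one_smul]
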